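/- Let A be a unital C*-algebra, p a projection in A, and a ∈ A. Then a is invertible up to (p,p) if and only if there exists a projection q in A such that a is invertible up to (p,q), qa(1−p) = 0, and 1−p is invertible up to (q,p). -/

import Mathlib

variable {A : Type*} [NormedRing A] [StarRing A] [CStarRing A] [CompleteSpace A]
  [NormedAlgebra ℂ A] [StarModule ℂ A]

/-- `p` is a projection: self-adjoint idempotent. -/
def IsProjE (p : A) : Prop := p * p = p ∧ star p = p

/-- `a` is invertible up to the pair of projections `(p, q)`. -/
def InvUpTo (a p q : A) : Prop :=
  ∃ b : A, b = (1 - p) * b * (1 - q) ∧ (1 - q) * a * (1 - p) * b = 1 - q ∧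
    b * ((1 - q) * a * (1 - p)) = 1 - p

/-- If `e` is idempotent then `e + star e - 1` is a unit. -/
theorem isUnit_aux (e : A) (he : e * e = e) : IsUnit (e + star e - 1) := by
  let _ : CStarAlgebra A := { }
  have hs : star e * star e = star e := by rw [← star_mul, he]
  have hsa : IsSelfAdjoint (Complex.I • (e - star e)) := by
    rw [IsSelfAdjoint, star_smul]
    simp
    rw [← smul_neg, neg_sub]
  have key : ∀ z : ℂ, z.im ≠ 0 →
      IsUnit (algebraMap ℂ A z - Complex.I • (e - star e)) := by
    intro z hz
    by_contra h
    have hm : z ∈ spectrum ℂ (Complex.I • (e - star e)) := h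
    have := hsa.mem_spectrum_eq_re hm
    apply hz
    rw [this]; simp
  have h1 := key Complex.I (by simp)
  have h2 := key (-Complex.I) (by simp)
  have h3 : IsUnit ((e + star e - 1) * (e + star e - 1)) := by
    have h4 : (e + star e - 1) * (e + star e - 1) =
        (algebraMap ℂ A Complex.I - Complex.I • (e - star e)) *
        (algebraMap ℂ A (-Complex.I) - Complex.I • (e - star e)) := by
      have e1 : algebraMap ℂ A Complex.I - Complex.I • (e - star e)
          = Complex.I • (1 - (e - star e)) := by
        rw [smul_sub _ 1, Algebra.algebraMap_eq_smul_one]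
      have e2 : algebraMap ℂ A (-Complex.I) - Complex.I • (e - star e)
          = (-Complex.I) • (1 + (e - star e)) := by
        rw [smul_add, Algebra.algebraMap_eq_smul_one, neg_smul, neg_smul, sub_eq_add_neg]
      rw [e1, e2, smul_mul_smul_comm]
      have e3 : Complex.I * -Complex.I = 1 := by simp
      rw [e3, one_smul]
      simp only [mul_add, add_mul, sub_mul, mul_sub, he, hs, one_mul, mul_one]
      abel
    rw [h4]; exact h1.mul h2
  exact ((Commute.refl _).isUnit_mul_iff.1 h3).1

/-- Range projection of an idempotent. -/
theorem range_proj (e : A) (he : e * e = e) :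
    ∃ Q : A, Q * Q = Q ∧ star Q = Q ∧ Q * e = e ∧ e * Q = Q := by
  have hs : star e * star e = star e := by rw [← star_mul, he]
  obtain ⟨w, hw⟩ := isUnit_aux e he
  obtain ⟨v, hv⟩ : ∃ v : A, v = (↑w⁻¹ : A) := ⟨_, rfl⟩
  have hwv : (w : A) * v = 1 := by rw [hv]; simp
  have hvw : v * (w : A) = 1 := by rw [hv]; simp
  have hwe : (w : A) * e = star e * w := by
    rw [hw]; simp only [mul_add, add_mul, sub_mul, mul_sub, he, hs, one_mul, mul_one]; abel
  have hew : e * (w : A) = e * star e := by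
    rw [hw]; simp only [mul_add, mul_sub, he, mul_one]; abel
  have hsw : star (w : A) = w := by
    rw [hw]; simp only [star_sub, star_add, star_star, star_one]; abel
  have hsv : star v = v := by
    have h : star v * (w : A) = 1 := by
      have := congrArg star hwv
      rwa [star_mul, hsw, star_one] at this
    calc star v = star v * (w * v) := by rw [hwv, mul_one]
      _ = v := by rw [← mul_assoc, h, one_mul]
  have hev : e * v = v * star e := by
    calc e * v = v * (w * e) * v := by rw [← mul_assoc, hvw, one_mul]
      _ = v * star e * (w * v) := by rw [hwe]; simp only [mul_assoc]
      _ = v * star e := by rw [hwv, mul_one]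
  have hQe : e * v * e = e := by
    have h : star e * e = w * e := by
      rw [hw]; simp only [add_mul, sub_mul, he, one_mul]; abel
    rw [hev, mul_assoc, h, ← mul_assoc, hvw, one_mul]
  refine ⟨e * v, ?_, ?_, hQe, ?_⟩
  · rw [← mul_assoc, hQe]
  · rw [star_mul, hsv, hev]
  · rw [← mul_assoc, he]

theorem invUpTo_pp_iff (a p : A) (hp : IsProjE p) :
    InvUpTo a p p ↔
      ∃ q : A, IsProjE q ∧ InvUpTo a p q ∧ q * a * (1 - p) = 0 ∧ InvUpTo (1 - p) q p := by
  unfold InvUpTo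
  obtain ⟨hpp, -⟩ := hp
  have hP : (1 - p) * (1 - p) = 1 - p := by
    simp only [mul_sub, sub_mul, hpp, one_mul, mul_one]; abel
  constructor
  · rintro ⟨b, hb1, hb2, hb3⟩
    generalize 1 - p = P at *
    have hPb : P * b = b := by
      rw [hb1]; simp only [← mul_assoc, hP]
    have hbP : b * P = b := by
      rw [hb1]; simp only [mul_assoc, hP]
    have hbx : b * (a * P) = P := by
      simp only [← mul_assoc, hbP] at hb3
      rwa [← mul_assoc]
    have he : (a * P * b) * (a * P * b) = a * P * b := by
      calc (a * P * b) * (a * P * b) = a * P * (b * (a * P)) * b := by simp only [mul_assoc]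
        _ = a * (P * P) * b := by rw [hbx]; simp only [mul_assoc]
        _ = _ := by rw [hP]
    obtain ⟨Q, hQQ, hQs, hQe, heQ⟩ := range_proj _ he
    have hQx : Q * a * P = a * P := by
      have : a * P * b * (a * P) = a * P := by
        rw [mul_assoc (a * P), hbx, mul_assoc, hP]
      calc Q * a * P = Q * (a * P * b * (a * P)) := by rw [this, mul_assoc]
        _ = a * P := by rw [← mul_assoc, hQe, this]
    refine ⟨1 - Q, ⟨?_, ?_⟩, ⟨b * Q, ?_, ?_, ?_⟩, ?_, ⟨a * P * b, ?_, ?_, ?_⟩⟩ <;>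
      try rw [sub_sub_cancel]
    · simp only [mul_sub, sub_mul, hQQ, one_mul, mul_one]; abel
    · rw [star_sub, star_one, hQs]
    · rw [← mul_assoc, hPb, mul_assoc, hQQ]
    · rw [hQx, ← mul_assoc, heQ]
    · rw [hQx, mul_assoc, ← mul_assoc Q, hQx, hbx]
    · rw [sub_mul, sub_mul, one_mul, hQx, sub_self]
    · rw [hQe, mul_assoc (a * P), hbP]
    · rw [hP, mul_assoc, hQe, ← mul_assoc, ← mul_assoc]; exact hb2
    · rw [hP, ← mul_assoc, mul_assoc (a * P), hbP, heQ]
  · rintro ⟨q, ⟨hqq, -⟩, ⟨c, hc1, hc2, hc3⟩, hq, ⟨d, hd1, hd2, hd3⟩⟩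
    have hx : (1 - q) * a * (1 - p) = a * (1 - p) := by
      rw [sub_mul, sub_mul, one_mul, hq, sub_zero]
    have hQQ : (1 - q) * (1 - q) = 1 - q := by
      simp only [mul_sub, sub_mul, hqq, one_mul, mul_one]; abel
    clear hq hqq hpp
    generalize 1 - p = P at *
    generalize 1 - q = Q at *
    have hPc : P * c = c := by
      rw [hc1]; simp only [← mul_assoc, hP]
    have hcQ : c * Q = c := by
      rw [hc1]; simp only [mul_assoc, hQQ]
    have hdP : d * P = d := by
      rw [hd1]; simp only [mul_assoc, hP]
    have hQd : Q * d = d := by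
      rw [hd1]; simp only [← mul_assoc, hQQ]
    rw [hP] at hd2 hd3
    rw [hx] at hc2 hc3
    refine ⟨c * d, ?_, ?_, ?_⟩
    · rw [← mul_assoc, hPc, mul_assoc, hdP]
    · calc P * a * P * (c * d) = P * (a * P * c) * d := by simp only [mul_assoc]
        _ = P := by rw [hc2, hd2]
    · calc c * d * (P * a * P) = c * (d * P) * (a * P) := by simp only [mul_assoc]
        _ = c * (d * P) * (Q * a * P) := by rw [hx]
        _ = c * (d * (P * Q)) * (a * P) := by simp only [mul_assoc]
        _ = P := by rw [hd3, hcQ, hc3]
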